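/- Every connected finite simple graph G = (V,E) with at least three vertices satisfies E(G) ≤ Σ_{v ∈ V'} √(3·l(v) + d(v)), where the sum runs over the inner vertices of G. -/

import Mathlib

open Finset

namespace GraphEnergy

variable {V : Type*} [Fintype V] [DecidableEq V]

/-- The adjacency matrix of a simple graph over `ℝ` is Hermitian. -/
theorem adjMatrix_isHermitian (G : SimpleGraph V) [DecidableRel G.Adj] :
    (G.adjMatrix ℝ).IsHermitian := by
  ext i j
  simp [Matrix.conjTranspose_apply, SimpleGraph.adj_comm]

/-- The energy of a finite simple graph: the sum of the absolute values of the
eigenvalues of its adjacency matrix. -/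
noncomputable def energy (G : SimpleGraph V) [DecidableRel G.Adj] : ℝ :=
  ∑ i, |(adjMatrix_isHermitian G).eigenvalues i|

/-- The set of inner vertices: vertices of degree at least 2. -/
def innerVerts (G : SimpleGraph V) [DecidableRel G.Adj] : Finset V :=
  univ.filter (fun v => 2 ≤ G.degree v)

/-- The set of leaves: vertices of degree 1. -/
def leaves (G : SimpleGraph V) [DecidableRel G.Adj] : Finset V :=
  univ.filter (fun v => G.degree v = 1)

/-- The number of neighbors of `v` that are leaves. -/
def leafCount (G : SimpleGraph V) [DecidableRel G.Adj] (v : V) : ℕ :=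
  ((G.neighborFinset v).filter (fun w => G.degree w = 1)).card

open scoped Classical in
/-- The number of edges both of whose endpoints are leaves. -/
noncomputable def e11 (G : SimpleGraph V) [DecidableRel G.Adj] : ℕ :=
  (G.edgeFinset.filter (fun e => ∀ v ∈ e, G.degree v = 1)).card

/-- A real symmetric matrix `A` is paired by the trace with a symmetric orthogonal matrix
so as to give the sum of the absolute values of the eigenvalues of `A`. -/
theorem exists_symm_orthogonal_trace_mul_eq {A : Matrix V V ℝ} (hA : A.IsHermitian) :
    ∃ S : Matrix V V ℝ, S.transpose = S ∧ S * S.transpose = 1 ∧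
      (A * S).trace = ∑ i, |hA.eigenvalues i| := by
  set U : Matrix V V ℝ := (hA.eigenvectorUnitary : Matrix V V ℝ) with hU
  have hUU : star U * U = 1 := Unitary.coe_star_mul_self hA.eigenvectorUnitary
  have hUU' : U * star U = 1 := Unitary.coe_mul_star_self hA.eigenvectorUnitary
  have hAU : A = U * Matrix.diagonal hA.eigenvalues * star U := by
    have h := hA.spectral_theorem
    rw [Unitary.conjStarAlgAut_apply] at h
    exact h
  set s : V → ℝ := fun i => if 0 ≤ hA.eigenvalues i then 1 else -1 with hs
  set D : Matrix V V ℝ := Matrix.diagonal s with hD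
  have hDD : D * D = 1 := by
    rw [hD, Matrix.diagonal_mul_diagonal, ← Matrix.diagonal_one]
    congr 1
    ext i
    by_cases h : 0 ≤ hA.eigenvalues i <;> simp [hs, h]
  have hstar : star U = U.transpose := by
    rw [Matrix.star_eq_conjTranspose, Matrix.conjTranspose_eq_transpose_of_trivial]
  have hS : (U * D * star U).transpose = U * D * star U := by
    rw [hstar, Matrix.transpose_mul, Matrix.transpose_mul, Matrix.transpose_transpose, hD,
      Matrix.diagonal_transpose, Matrix.mul_assoc]
  refine ⟨U * D * star U, hS, ?_, ?_⟩
  · rw [hS]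
    calc U * D * star U * (U * D * star U) = U * (D * ((star U * U) * D)) * star U := by
          simp only [Matrix.mul_assoc]
      _ = 1 := by rw [hUU, Matrix.one_mul, hDD, Matrix.mul_one, hUU']
  · have h : A * (U * D * star U) = U * (Matrix.diagonal hA.eigenvalues * D) * star U := by
      calc A * (U * D * star U)
          = U * Matrix.diagonal hA.eigenvalues * ((star U * U) * D) * star U := by
            nth_rewrite 1 [hAU]
            simp only [Matrix.mul_assoc]
        _ = U * (Matrix.diagonal hA.eigenvalues * D) * star U := by
            rw [hUU, Matrix.one_mul, Matrix.mul_assoc U]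
    rw [h, Matrix.trace_mul_comm, ← Matrix.mul_assoc, hUU, Matrix.one_mul, hD,
      Matrix.diagonal_mul_diagonal, Matrix.trace_diagonal]
    refine sum_congr rfl fun i _ => ?_
    by_cases hi : 0 ≤ hA.eigenvalues i
    · simp [hs, hi, abs_of_nonneg hi]
    · simp [hs, hi, abs_of_neg (not_le.mp hi)]

/-- If `A = W + Wᵀ`, then the sum of the absolute values of the eigenvalues of `A` is at most
twice the sum of the Euclidean norms of the rows of `W`. -/
theorem sum_abs_eigenvalues_le_of_eq_add_transpose {A W : Matrix V V ℝ} (hA : A.IsHermitian)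
    (hW : A = W + W.transpose) :
    ∑ i, |hA.eigenvalues i| ≤ ∑ v, 2 * Real.sqrt (∑ w, W v w ^ 2) := by
  obtain ⟨S, hS, hSS, htr⟩ := exists_symm_orthogonal_trace_mul_eq hA
  have hrow (v : V) : ∑ w, S v w ^ 2 = 1 := by
    have h := congrFun (congrFun hSS v) v
    simpa [Matrix.mul_apply, pow_two] using h
  have htrace : (A * S).trace = 2 * (W * S).trace := by
    have h : (W.transpose * S).trace = (W * S).trace := by
      rw [← Matrix.trace_transpose, Matrix.transpose_mul, Matrix.transpose_transpose, hS,
        Matrix.trace_mul_comm]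
    rw [hW, Matrix.add_mul, Matrix.trace_add, h]
    ring
  rw [← htr, htrace, ← mul_sum]
  refine mul_le_mul_of_nonneg_left ?_ zero_le_two
  refine sum_le_sum fun v _ => ?_
  calc (W * S) v v = ∑ w, W v w * S v w := by
        rw [Matrix.mul_apply]
        refine sum_congr rfl fun w _ => ?_
        rw [← Matrix.transpose_apply S, hS]
    _ ≤ Real.sqrt (∑ w, W v w ^ 2) * Real.sqrt (∑ w, S v w ^ 2) :=
        Real.sum_mul_le_sqrt_mul_sqrt _ _ _
    _ = Real.sqrt (∑ w, W v w ^ 2) := by rw [hrow, Real.sqrt_one, mul_one]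

/-- In a connected graph with at least three vertices, no two leaves are adjacent. -/
theorem degree_ne_one_of_adj_of_degree_eq_one (G : SimpleGraph V) [DecidableRel G.Adj]
    (hconn : G.Connected) (hcard : 3 ≤ Fintype.card V) {x y : V} (hxy : G.Adj x y)
    (hx : G.degree x = 1) : G.degree y ≠ 1 := by
  intro hy
  obtain ⟨a, -, ha⟩ := G.degree_eq_one_iff_existsUnique_adj.mp hx
  obtain ⟨b, -, hb⟩ := G.degree_eq_one_iff_existsUnique_adj.mp hy
  have key (z : V) : z = x ∨ z = y := by
    have h := G.reachable_iff_reflTransGen x z |>.mp (hconn.preconnected x z)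
    induction h with
    | refl => exact Or.inl rfl
    | tail _ hadj ih =>
      rcases ih with rfl | rfl
      · exact Or.inr ((ha _ hadj).trans (ha _ hxy).symm)
      · exact Or.inl ((hb _ hadj).trans (hb _ hxy.symm).symm)
  have hle : (univ : Finset V).card ≤ ({x, y} : Finset V).card :=
    card_le_card fun z _ => by simpa using key z
  have := card_le_two (a := x) (b := y)
  rw [card_univ] at hle
  omega

/-- The weights of the decomposition of a graph into stars centred at its inner vertices:
an edge to a leaf has weight `1`, an edge to another inner vertex weight `1 / 2`. -/
noncomputable def starWeight (G : SimpleGraph V) [DecidableRel G.Adj] : Matrix V V ℝ :=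
  fun v w => if 2 ≤ G.degree v ∧ G.Adj v w then (if G.degree w = 1 then 1 else 1 / 2) else 0

theorem adjMatrix_eq_starWeight_add_transpose (G : SimpleGraph V) [DecidableRel G.Adj]
    (hconn : G.Connected) (hcard : 3 ≤ Fintype.card V) :
    G.adjMatrix ℝ = starWeight G + (starWeight G).transpose := by
  ext x y
  rw [Matrix.add_apply, Matrix.transpose_apply, SimpleGraph.adjMatrix_apply, starWeight,
    starWeight]
  by_cases hxy : G.Adj x y
  · have hx : 0 < G.degree x := (G.degree_pos_iff_exists_adj x).mpr ⟨y, hxy⟩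
    have hy : 0 < G.degree y := (G.degree_pos_iff_exists_adj y).mpr ⟨x, hxy.symm⟩
    have hne := degree_ne_one_of_adj_of_degree_eq_one G hconn hcard hxy
    by_cases h1 : G.degree x = 1
    · have h2 : 2 ≤ G.degree y := by have := hne h1; omega
      simp [hxy, hxy.symm, h1, h2]
    · have h1' : 2 ≤ G.degree x := by omega
      by_cases h2 : G.degree y = 1
      · simp [hxy, hxy.symm, h1', h2]
      · have h2' : 2 ≤ G.degree y := by omega
        simp only [hxy, hxy.symm, h1', h2', h1, h2, and_self, if_true, if_false]
        norm_num
  · simp [hxy, mt SimpleGraph.Adj.symm hxy]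

theorem sum_starWeight_sq (G : SimpleGraph V) [DecidableRel G.Adj] {v : V}
    (hv : 2 ≤ G.degree v) :
    4 * ∑ w, starWeight G v w ^ 2 = 3 * (leafCount G v : ℝ) + (G.degree v : ℝ) := by
  have h (w : V) : 4 * starWeight G v w ^ 2 =
      3 * (if G.Adj v w ∧ G.degree w = 1 then 1 else 0) + (if G.Adj v w then 1 else 0) := by
    by_cases h1 : G.Adj v w <;> by_cases h2 : G.degree w = 1 <;>
      simp [starWeight, hv, h1, h2] <;> norm_num
  rw [mul_sum, sum_congr rfl fun w _ => h w, sum_add_distrib, ← mul_sum, sum_boole, sum_boole,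
    leafCount, ← G.card_neighborFinset_eq_degree, G.neighborFinset_eq_filter, filter_filter]

/-- Every connected graph with at least three vertices satisfies
`E(G) ≤ ∑_{v ∈ V'} √(3 l(v) + d(v))`. -/
theorem energy_le_sum_inner_sqrt (G : SimpleGraph V) [DecidableRel G.Adj]
    (hconn : G.Connected) (hcard : 3 ≤ Fintype.card V) :
    energy G ≤ ∑ v ∈ innerVerts G,
      Real.sqrt (3 * (leafCount G v : ℝ) + (G.degree v : ℝ)) := by
  have h := sum_abs_eigenvalues_le_of_eq_add_transpose (adjMatrix_isHermitian G)
    (adjMatrix_eq_starWeight_add_transpose G hconn hcard)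
  refine h.trans_eq ?_
  rw [innerVerts, sum_filter]
  refine sum_congr rfl fun v _ => ?_
  split_ifs with hv
  · rw [← sum_starWeight_sq G hv, Real.sqrt_mul (by norm_num),
      show (4 : ℝ) = 2 ^ 2 by norm_num, Real.sqrt_sq zero_le_two]
  · simp [starWeight, hv]

end GraphEnergy
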